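/- arXiv:2602.10486 — 9 statements merged into one kernel-verified Lean document; each statement's English description precedes it below -/
import Mathlib

section
/- (Convergence to the least common fixed point under a fair schedule.) Let L be a finite lattice with bottom element ⊥ and let f_1, …, f_m : L → L all be inflationary and monotone. Let σ : ℕ → {1,…,m} be a fair schedule and define G_0 = ⊥ and G_{t+1} = f_{σ(t)}(G_t). Then there exists T such that G_t = G_T for all t ≥ T, and G_T is the least common fixed point of the family: f_i(G_T) = G_T for every i, and G_T ≤ Y for every Y with f_i(Y) = Y for all i. -/
/-- On a finite lattice with ⊥, a fair interleaved iteration of inflationary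
monotone functions starting from ⊥ stabilizes at the least common fixed point. -/
theorem stmt_2 {L : Type*} [Lattice L] [Fintype L] [OrderBot L]
    {m : ℕ} (f : Fin m → L → L)
    (hinf : ∀ i (G : L), G ≤ f i G) (hmono : ∀ i, Monotone (f i))
    (σ : ℕ → Fin m) (hfair : ∀ i, {t | σ t = i}.Infinite)
    (G : ℕ → L) (hG0 : G 0 = ⊥) (hstep : ∀ t, G (t + 1) = f (σ t) (G t)) :
    ∃ T, (∀ t, T ≤ t → G t = G T) ∧ (∀ i, f i (G T) = G T) ∧
      ∀ Y : L, (∀ i, f i Y = Y) → G T ≤ Y := by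
  have hG : Monotone G := monotone_nat_of_le_succ fun t => by
    rw [hstep]
    exact hinf _ _
  obtain ⟨T, hT⟩ := WellFoundedGT.monotone_chain_condition ⟨G, hG⟩
  have hstable : ∀ t, T ≤ t → G t = G T := fun t ht => (hT t ht).symm
  refine ⟨T, hstable, fun i => ?_, fun Y hY => ?_⟩
  · obtain ⟨t, rfl, ht⟩ := (hfair i).exists_gt T
    have h := hstep t
    rw [hstable t ht.le, hstable (t + 1) (by omega)] at h
    exact h.symm
  · have hle : ∀ t, G t ≤ Y := fun t => by
      induction t with
      | zero => exact hG0 ▸ bot_le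
      | succ t ih =>
        rw [hstep, ← hY (σ t)]
        exact hmono _ ih
    exact hle T
end

section
/- (Monotone round progress.) Let L = (Fin n → {0,…,m}) be ordered componentwise and let f_i : L → L be inflationary for every i in a set S ⊆ Fin n. Suppose (G, S, (X_i)_{i∈S}, G') is a round with update-only-on-change semantics. Then: (1) for every i ∈ S and every coordinate j, X_i j ≥ G j, and in particular every written value satisfies f_i(X_i) j ≥ G j whenever f_i(X_i) j ≠ X_i j; (2) G' ≥ G componentwise; (3) for every coordinate j, G' j = G j if and only if no i ∈ S writes coordinate j, i.e., if and only if f_i(X_i) j = X_i j for all i ∈ S. -/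
/-- A round with update-only-on-change semantics from state `G`, with active set `S`,
read vectors `X i` (for `i ∈ S`), and committed result `G'`.
A write to coordinate `j` by `i'` occurs exactly when `f i' (X i') j ≠ X i' j`. -/
def UpdateRound {n m : ℕ} (f : Fin n → (Fin n → Fin (m + 1)) → Fin n → Fin (m + 1))
    (S : Set (Fin n)) (G : Fin n → Fin (m + 1))
    (X : Fin n → Fin n → Fin (m + 1)) (G' : Fin n → Fin (m + 1)) : Prop :=
  (∀ i ∈ S, ∀ j, X i j = G j ∨
      ∃ i' ∈ S, f i' (X i') j ≠ X i' j ∧ X i j = f i' (X i') j) ∧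
  (∀ j, (∀ i ∈ S, f i (X i) j = X i j) → G' j = G j) ∧
  (∀ j, (∃ i ∈ S, f i (X i) j ≠ X i j) →
      ∃ i' ∈ S, f i' (X i') j ≠ X i' j ∧ G' j = f i' (X i') j)

/-- Reads never fall below the starting state: a value read from another writer strictly exceeds
that writer's own read, so chains of reads descend to the starting value. -/
theorem UpdateRound.le_read {n m : ℕ} {f : Fin n → (Fin n → Fin (m + 1)) → Fin n → Fin (m + 1)}
    {S : Set (Fin n)} (hinf : ∀ i ∈ S, ∀ G : Fin n → Fin (m + 1), G ≤ f i G)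
    {G G' : Fin n → Fin (m + 1)} {X : Fin n → Fin n → Fin (m + 1)}
    (hround : UpdateRound f S G X G') (j : Fin n) {i : Fin n} (hi : i ∈ S) : G j ≤ X i j := by
  induction hv : X i j using WellFoundedLT.induction generalizing i with
  | ind v ih =>
    subst hv
    rcases hround.1 i hi j with h | ⟨k, hk, hne, h⟩
    · exact h.ge
    · have hlt : X k j < X i j := h ▸ lt_of_le_of_ne (hinf k hk (X k) j) hne.symm
      exact (ih _ hlt hk rfl).trans hlt.le

/-- Every written value strictly exceeds the starting state. -/
theorem UpdateRound.lt_write {n m : ℕ} {f : Fin n → (Fin n → Fin (m + 1)) → Fin n → Fin (m + 1)}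
    {S : Set (Fin n)} (hinf : ∀ i ∈ S, ∀ G : Fin n → Fin (m + 1), G ≤ f i G)
    {G G' : Fin n → Fin (m + 1)} {X : Fin n → Fin n → Fin (m + 1)}
    (hround : UpdateRound f S G X G') {i j : Fin n} (hi : i ∈ S) (hw : f i (X i) j ≠ X i j) :
    G j < f i (X i) j :=
  (hround.le_read hinf j hi).trans_lt (lt_of_le_of_ne (hinf i hi (X i) j) hw.symm)

/-- Monotone round progress: reads are above the round's starting state,
written values are above the starting state, the committed state dominates the starting
state, and a coordinate is unchanged iff nobody writes it. -/
theorem stmt_4 {n m : ℕ} (f : Fin n → (Fin n → Fin (m + 1)) → Fin n → Fin (m + 1))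
    (S : Set (Fin n)) (hinf : ∀ i ∈ S, ∀ G : Fin n → Fin (m + 1), G ≤ f i G)
    (G G' : Fin n → Fin (m + 1)) (X : Fin n → Fin n → Fin (m + 1))
    (hround : UpdateRound f S G X G') :
    (∀ i ∈ S, ∀ j, G j ≤ X i j) ∧
    (∀ i ∈ S, ∀ j, f i (X i) j ≠ X i j → G j ≤ f i (X i) j) ∧
    (∀ j, G j ≤ G' j) ∧
    (∀ j, G' j = G j ↔ ∀ i ∈ S, f i (X i) j = X i j) := by
  have hcommit (j : Fin n) (hw : ∃ i ∈ S, f i (X i) j ≠ X i j) : G j < G' j := by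
    obtain ⟨k, hk, hne, h⟩ := hround.2.2 j hw
    exact h ▸ hround.lt_write hinf hk hne
  refine ⟨fun i hi j => hround.le_read hinf j hi,
    fun i hi j hw => (hround.lt_write hinf hi hw).le, fun j => ?_,
    fun j => ⟨fun h => ?_, hround.2.1 j⟩⟩
  · by_cases hw : ∃ i ∈ S, f i (X i) j ≠ X i j
    · exact (hcommit j hw).le
    · push Not at hw
      exact (hround.2.1 j hw).ge
  · by_contra! hw
    exact (hcommit j hw).ne' h
end

section
/- (Distributed least fixed point theorem.) Let L = (Fin n → {0,…,m}) be ordered componentwise with bottom element ⊥ = (0,…,0), and let f_1, …, f_n : L → L all be monotone, inflationary, and i-local (f_i is i-local). Fix staleness bound T ∈ ℕ and fairness window τ ∈ ℕ, τ ≥ 1. Consider sequences G : ℕ → L, S : ℕ → Set (Fin n), and views Ĝ : ℕ → Fin n → L with G_0 = ⊥ such that for all t and i: (a) Ĝ_t^i i = G_t i (a process always reads its own coordinate fresh); (b) for every coordinate j there exists s with max(0, t−T) ≤ s ≤ t and Ĝ_t^i j = G_s j (bounded staleness); (c) G_{t+1} i = f_i(Ĝ_t^i) i when i ∈ S_t and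 G_{t+1} i = G_t i when i ∉ S_t (coordinatewise commit rule); and (d) for every t and i there exists s with t ≤ s < t+τ and i ∈ S_s (strong fairness). Then there exists U such that G_t = G_U for all t ≥ U, and G_U is the least common fixed point of {f_1,…,f_n}: f_i(G_U) = G_U for every i, and G_U ≤ Y for every Y with f_i(Y) = Y for all i. -/
/-- Distributed least fixed point theorem: with monotone, inflationary,
`i`-local functions, bounded staleness `T`, strong fairness window `τ ≥ 1`, fresh own
coordinates, and the coordinatewise commit rule, the execution starting at ⊥ = (0,…,0)
stabilizes at the least common fixed point. -/
theorem stmt_6 {n m : ℕ} (f : Fin n → (Fin n → Fin (m + 1)) → Fin n → Fin (m + 1))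
    (hmono : ∀ i, Monotone (f i))
    (hinf : ∀ i (G : Fin n → Fin (m + 1)), G ≤ f i G)
    (hlocal : ∀ i (G : Fin n → Fin (m + 1)) j, j ≠ i → f i G j = G j)
    (T τ : ℕ) (hτ : 1 ≤ τ)
    (G : ℕ → Fin n → Fin (m + 1)) (S : ℕ → Set (Fin n))
    (V : ℕ → Fin n → Fin n → Fin (m + 1))
    (hG0 : G 0 = fun _ => 0)
    (hfresh : ∀ t i, V t i i = G t i)
    (hstale : ∀ t i j, ∃ s, t - T ≤ s ∧ s ≤ t ∧ V t i j = G s j)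
    (hcommit : ∀ t i, (i ∈ S t → G (t + 1) i = f i (V t i) i) ∧
      (i ∉ S t → G (t + 1) i = G t i))
    (hfair : ∀ t i, ∃ s, t ≤ s ∧ s < t + τ ∧ i ∈ S s) :
    ∃ U, (∀ t, U ≤ t → G t = G U) ∧ (∀ i, f i (G U) = G U) ∧
      ∀ Y : Fin n → Fin (m + 1), (∀ i, f i Y = Y) → G U ≤ Y := by
  have hstep : ∀ t, G t ≤ G (t + 1) := by
    intro t i
    by_cases hi : i ∈ S t
    · rw [(hcommit t i).1 hi, ← hfresh t i]
      exact hinf i (V t i) i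
    · exact ((hcommit t i).2 hi).ge
  obtain ⟨U, hU⟩ := WellFoundedGT.monotone_chain_condition
    (⟨G, monotone_nat_of_le_succ hstep⟩ : ℕ →o (Fin n → Fin (m + 1)))
  replace hU : ∀ t, U ≤ t → G t = G U := fun t ht => (hU t ht).symm
  refine ⟨U, hU, fun i => ?_, fun Y hY => ?_⟩
  · obtain ⟨s, hs, -, hi⟩ := hfair (U + T) i
    have hV : V s i = G U := by
      funext j
      obtain ⟨r, hr, -, hrV⟩ := hstale s i j
      rw [hrV, hU r (by omega)]
    funext j
    by_cases hj : j = i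
    · subst hj
      rw [← hV, ← (hcommit s j).1 hi, hU (s + 1) (by omega), hV]
    · exact hlocal i (G U) j hj
  · have hbelow : ∀ t, ∀ s ≤ t, G s ≤ Y := by
      intro t
      induction t with
      | zero =>
        intro s hs
        rw [Nat.le_zero.mp hs, hG0]
        exact fun i => Fin.zero_le (Y i)
      | succ t ih =>
        intro s hs
        rcases Nat.le_succ_iff.mp hs with hs | rfl
        · exact ih s hs
        intro i
        by_cases hi : i ∈ S t
        · have hV : V t i ≤ Y := by
            intro j
            obtain ⟨r, -, hr, hrV⟩ := hstale t i j
            exact hrV.trans_le (ih r hr j)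
          rw [(hcommit t i).1 hi]
          exact (hmono i hV i).trans_eq (congrFun (hY i) i)
        · rw [(hcommit t i).2 hi]
          exact ih t le_rfl i
    exact hbelow U U le_rfl
end

section
/- (Greatest common fixed point under interleaving execution.) Let L be a finite lattice with top element ⊤ and let f_1, …, f_m : L → L all be deflationary and monotone. Let σ : ℕ → {1,…,m} be a fair schedule and define G_0 = ⊤ and G_{t+1} = f_{σ(t)}(G_t). Then there exists T such that G_t = G_T for all t ≥ T, and G_T is the greatest common fixed point of the family: f_i(G_T) = G_T for every i, and G_T ≥ Y for every Y with f_i(Y) = Y for all i. -/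
/-- Greatest common fixed point under interleaving execution: on a finite
lattice with ⊤, a fair interleaved iteration of deflationary monotone functions starting
from ⊤ stabilizes at the greatest common fixed point. -/
theorem stmt_8 {L : Type*} [Lattice L] [Fintype L] [OrderTop L]
    {m : ℕ} (f : Fin m → L → L)
    (hdef : ∀ i (G : L), f i G ≤ G) (hmono : ∀ i, Monotone (f i))
    (σ : ℕ → Fin m) (hfair : ∀ i, {t | σ t = i}.Infinite)
    (G : ℕ → L) (hG0 : G 0 = ⊤) (hstep : ∀ t, G (t + 1) = f (σ t) (G t)) :
    ∃ T, (∀ t, T ≤ t → G t = G T) ∧ (∀ i, f i (G T) = G T) ∧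
      ∀ Y : L, (∀ i, f i Y = Y) → Y ≤ G T := by
  have hanti : Antitone G := antitone_nat_of_succ_le fun t => hstep t ▸ hdef _ _
  obtain ⟨_, ⟨T, rfl⟩, hmin⟩ :=
    (wellFounded_lt (α := L)).has_min (Set.range G) (Set.range_nonempty G)
  have hstable : ∀ t, T ≤ t → G t = G T := fun t ht =>
    (hanti ht).eq_of_not_lt (hmin _ ⟨t, rfl⟩)
  refine ⟨T, hstable, fun i => ?_, fun Y hY => ?_⟩
  · obtain ⟨t, rfl, ht⟩ := (hfair i).exists_gt T
    rw [← hstable t ht.le, ← hstep, hstable t ht.le, hstable (t + 1) (by omega)]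
  · have hle : ∀ t, Y ≤ G t := by
      intro t
      induction t with
      | zero => exact hG0 ▸ le_top
      | succ t ih =>
        rw [hstep, ← hY (σ t)]
        exact hmono _ ih
    exact hle T
end

section
/- (Greatest common fixed point under distributed execution.) Let L = (Fin n → {0,…,m}) be ordered componentwise with top element ⊤ = (m,…,m), and let f_1, …, f_n : L → L all be monotone, deflationary, and i-local (f_i is i-local). Fix staleness bound T ∈ ℕ and fairness window τ ∈ ℕ, τ ≥ 1. Consider sequences G : ℕ → L, S : ℕ → Set (Fin n), and views Ĝ : ℕ → Fin n → L with G_0 = ⊤ such that for all t and i: (a) Ĝ_t^i i = G_t i; (b) for every coordinate j there exists s with max(0, t−T) ≤ s ≤ t and Ĝ_t^i j = G_s j; (c) G_{t+1} i = f_i(Ĝ_t^i) i when i ∈ S_t and G_{t+1} i = G_t i when i ∉ S_t; and (d) for every t and i there exists s with t ≤ s < t+τ and i ∈ S_s. Then there exists U such that G_t = G_U for all t ≥ U, and G_U is the greatest common fixed point of {f_1,…,f_n}: f_i(G_U) = G_U for every i, and G_U ≥ Y for every Y with f_i(Y) = Y for all i. -/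
/-- Greatest common fixed point under distributed execution: with monotone,
deflationary, `i`-local functions, bounded staleness `T`, strong fairness window `τ ≥ 1`,
fresh own coordinates, and the coordinatewise commit rule, the execution starting at
⊤ = (m,…,m) stabilizes at the greatest common fixed point. -/
theorem stmt_9 {n m : ℕ} (f : Fin n → (Fin n → Fin (m + 1)) → Fin n → Fin (m + 1))
    (hmono : ∀ i, Monotone (f i))
    (hdef : ∀ i (G : Fin n → Fin (m + 1)), f i G ≤ G)
    (hlocal : ∀ i (G : Fin n → Fin (m + 1)) j, j ≠ i → f i G j = G j)
    (T τ : ℕ) (hτ : 1 ≤ τ)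
    (G : ℕ → Fin n → Fin (m + 1)) (S : ℕ → Set (Fin n))
    (V : ℕ → Fin n → Fin n → Fin (m + 1))
    (hG0 : G 0 = fun _ => Fin.last m)
    (hfresh : ∀ t i, V t i i = G t i)
    (hstale : ∀ t i j, ∃ s, t - T ≤ s ∧ s ≤ t ∧ V t i j = G s j)
    (hcommit : ∀ t i, (i ∈ S t → G (t + 1) i = f i (V t i) i) ∧
      (i ∉ S t → G (t + 1) i = G t i))
    (hfair : ∀ t i, ∃ s, t ≤ s ∧ s < t + τ ∧ i ∈ S s) :
    ∃ U, (∀ t, U ≤ t → G t = G U) ∧ (∀ i, f i (G U) = G U) ∧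
      ∀ Y : Fin n → Fin (m + 1), (∀ i, f i Y = Y) → Y ≤ G U := by
  have hanti : Antitone G := antitone_nat_of_succ_le fun t i => by
    by_cases hi : i ∈ S t
    · rw [(hcommit t i).1 hi, ← hfresh t i]
      exact hdef i (V t i) i
    · exact ((hcommit t i).2 hi).le
  obtain ⟨U, hU⟩ := WellFoundedGT.monotone_chain_condition
    (⟨fun t => OrderDual.toDual (G t), fun _ _ h => hanti h⟩ : ℕ →o (Fin n → Fin (m + 1))ᵒᵈ)
  have hstable : ∀ t, U ≤ t → G t = G U := fun t ht => (hU t ht).symm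
  refine ⟨U, hstable, fun i => ?_, fun Y hY => ?_⟩
  · obtain ⟨s, hs, -, hi⟩ := hfair (U + T) i
    have hview : V s i = G U := by
      funext j
      obtain ⟨r, hr, -, hj⟩ := hstale s i j
      rw [hj, hstable r (by omega)]
    funext j
    by_cases hj : j = i
    · subst hj
      rw [← hstable (s + 1) (by omega), (hcommit s j).1 hi, hview, hstable (s + 1) (by omega)]
    · exact hlocal i _ j hj
  · suffices h : ∀ t, Y ≤ G t from h U
    intro t
    induction t using Nat.strong_induction_on with
    | _ t ih =>
      cases t with
      | zero => exact hG0 ▸ fun i => Fin.le_last _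
      | succ t =>
        intro i
        by_cases hi : i ∈ S t
        · have hview : Y ≤ V t i := fun j => by
            obtain ⟨r, -, hr, hj⟩ := hstale t i j
            exact hj ▸ ih r (by omega) j
          rw [(hcommit t i).1 hi, ← hY i]
          exact hmono i hview i
        · rw [(hcommit t i).2 hi]
          exact ih t (by omega) i
end

section
/- (Transitive closure via fair interleaved fixed-point iteration.) Let E ⊆ Fin n × Fin n be the edge set of a directed graph, let L = (Fin n → Fin n → Bool) be ordered componentwise (false < true), and let R_0 ∈ L be given by R_0 a b = true iff (a,b) ∈ E or a = b. For each pair (a,b), each f_{a,b} : L → L is monotone and inflationary. Moreover, for any fair schedule σ : ℕ → Fin n × Fin n, the execution R_{t+1} = f_{σ(t)}(R_t) starting from R_0 stabilizes: there exists T with R_t = R_T for all t ≥ T, and R_T a b = true if and only if b is reachable from a, i.e., Relation.ReflTransGen (fun x y => (x,y) ∈ E) a b holds. -/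
/-- The reachability update function `f_{a,b}`: it recomputes coordinate `(a,b)` as
`R a b || (∃ k, R a k && R k b)` and leaves all other coordinates unchanged. -/
def tcUpdate {n : ℕ} (a b : Fin n) (R : Fin n → Fin n → Bool) :
    Fin n → Fin n → Bool :=
  fun x y =>
    if x = a ∧ y = b then R a b || decide (∃ k, R a k = true ∧ R k b = true)
    else R x y

theorem tcUpdate_eq_true_iff {n : ℕ} {a b x y : Fin n} {R : Fin n → Fin n → Bool} :
    tcUpdate a b R x y = true ↔
      R x y = true ∨ x = a ∧ y = b ∧ ∃ k, R a k = true ∧ R k b = true := by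
  unfold tcUpdate
  split_ifs with h
  · obtain ⟨rfl, rfl⟩ := h
    simp
  · simp only [iff_self_or]
    exact fun h' => absurd ⟨h'.1, h'.2.1⟩ h

theorem le_tcUpdate {n : ℕ} (a b : Fin n) (R : Fin n → Fin n → Bool) :
    R ≤ tcUpdate a b R :=
  fun _ _ => Bool.le_iff_imp.2 fun h => tcUpdate_eq_true_iff.2 (Or.inl h)

theorem tcUpdate_monotone {n : ℕ} (a b : Fin n) : Monotone (tcUpdate (n := n) a b) := by
  intro P Q hPQ x y
  have hle : ∀ u v, P u v = true → Q u v = true := fun u v => Bool.le_iff_imp.1 (hPQ u v)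
  rw [Bool.le_iff_imp, tcUpdate_eq_true_iff, tcUpdate_eq_true_iff]
  rintro (h | ⟨hx, hy, k, hak, hkb⟩)
  · exact Or.inl (hle _ _ h)
  · exact Or.inr ⟨hx, hy, k, hle _ _ hak, hle _ _ hkb⟩

/-- Transitive closure via fair interleaved fixed-point iteration:
each `tcUpdate a b` is inflationary and monotone (componentwise, false < true), and a
fair interleaved execution starting from `R₀` (edges plus diagonal) stabilizes at the
reachability relation. -/
theorem stmt_11 {n : ℕ} (E : Set (Fin n × Fin n)) (R : ℕ → Fin n → Fin n → Bool)
    (hR0 : ∀ a b, R 0 a b = true ↔ ((a, b) ∈ E ∨ a = b))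
    (σ : ℕ → Fin n × Fin n) (hfair : ∀ p, {t | σ t = p}.Infinite)
    (hstep : ∀ t, R (t + 1) = tcUpdate (σ t).1 (σ t).2 (R t)) :
    (∀ a b : Fin n, (∀ Q : Fin n → Fin n → Bool, Q ≤ tcUpdate a b Q) ∧
        Monotone (tcUpdate a b)) ∧
    ∃ T, (∀ t, T ≤ t → R t = R T) ∧
      ∀ a b, R T a b = true ↔ Relation.ReflTransGen (fun x y => (x, y) ∈ E) a b := by
  refine ⟨fun a b => ⟨le_tcUpdate a b, tcUpdate_monotone a b⟩, ?_⟩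
  have hmono : Monotone R := monotone_nat_of_le_succ fun t => by
    rw [hstep]
    exact le_tcUpdate _ _ _
  obtain ⟨T, hT⟩ := WellFoundedGT.monotone_chain_condition ⟨R, hmono⟩
  have hstable : ∀ t, T ≤ t → R t = R T := fun t ht => (hT t ht).symm
  have hsound : ∀ t a b, R t a b = true →
      Relation.ReflTransGen (fun x y => (x, y) ∈ E) a b := by
    intro t
    induction t with
    | zero =>
      intro a b h
      rcases (hR0 a b).1 h with h | rfl
      · exact .single h
      · exact .refl
    | succ t ih =>
      intro a b h
      rw [hstep, tcUpdate_eq_true_iff] at h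
      rcases h with h | ⟨rfl, rfl, k, hak, hkb⟩
      · exact ih _ _ h
      · exact (ih _ _ hak).trans (ih _ _ hkb)
  have hinit : ∀ a b, (a, b) ∈ E ∨ a = b → R T a b = true := fun a b h =>
    Bool.le_iff_imp.1 (hmono (Nat.zero_le T) a b) ((hR0 a b).2 h)
  have htrans : ∀ a k b, R T a k = true → R T k b = true → R T a b = true := by
    intro a k b hak hkb
    obtain ⟨t, ht, hTt⟩ := (hfair (a, b)).exists_gt T
    have hfix := hstep t
    rw [show σ t = (a, b) from ht, hstable t hTt.le, hstable (t + 1) (by omega)] at hfix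
    rw [hfix, tcUpdate_eq_true_iff]
    exact Or.inr ⟨rfl, rfl, k, hak, hkb⟩
  refine ⟨T, hstable, fun a b => ⟨hsound T a b, fun h => ?_⟩⟩
  induction h with
  | refl => exact hinit _ _ (Or.inr rfl)
  | tail _ hbc ih => exact htrans _ _ _ ih (hinit _ _ (Or.inl hbc))
end

section
/- (Correctness of lock-free Gale–Shapley under fair interleaving.) Consider n men and n women with strict preferences: for each man i, mpref i : {1,…,n} → {1,…,n} is a bijection sending positions to women (position 1 is most preferred), and for each woman w, rank w : {1,…,n} → {1,…,n} is a bijection over men (smaller rank is more preferred). Let L = ({0,1,…,n+1})^n and define f_i : L → L by: if G[i] = 0, increment G[i] to 1; if G[i] ≥ n+1, return G unchanged; otherwise, letting w = mpref i (G[i]), if there exists j ≠ i with 1 ≤ G[j] ≤ n, mpref j (G[j]) = w, and rank w j < rank w i, then increment G[i] by 1, else return G unchanged; all other coordinates are unchanged. Let σ : ℕ → {1,…,n} be a fair schedule, G_0 = (0,…,0), and G_{t+1} = f_{σ(t)}(G_t). Then there exists T with G_t = G_T =: G* for all t ≥ T; moreover 1 ≤ G*[i] ≤ n for every man i, the map μ(i)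 = mpref i (G*[i]) is a bijection from men to women, μ is a stable matching (there is no man i and woman w with (mpref i)⁻¹(w) < G*[i] and rank w i < rank w (μ⁻¹(w))), and μ is man-optimal: for every stable perfect matching ν and every man i, (mpref i)⁻¹(μ(i)) ≤ (mpref i)⁻¹(ν(i)). -/
open Classical in
/-- The lock-free Gale–Shapley proposal update `f_i`: positions are `1,…,n` (`0` means
man `i` has not proposed yet, `n+1` means he exhausted his list); `mpref i k` is the
woman at position `k` of man `i`'s list, and `rank w j` is woman `w`'s rank of man `j`
(smaller is preferred). -/
noncomputable def gsUpdate {n : ℕ} (mpref : Fin n → ℕ → Fin n)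
    (rank : Fin n → Fin n → ℕ) (i : Fin n) (G : Fin n → ℕ) : Fin n → ℕ :=
  fun i' =>
    if i' = i then
      if G i = 0 then 1
      else if n + 1 ≤ G i then G i
      else if ∃ j, j ≠ i ∧ 1 ≤ G j ∧ G j ≤ n ∧ mpref j (G j) = mpref i (G i) ∧
          rank (mpref i (G i)) j < rank (mpref i (G i)) i
        then G i + 1
        else G i
    else G i'

section GaleShapley

variable {n : ℕ} {mpref : Fin n → ℕ → Fin n} {rank : Fin n → Fin n → ℕ}

/-- Man `j` currently proposes to `w`, who strictly prefers him to `i`. -/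
def Outbids (mpref : Fin n → ℕ → Fin n) (rank : Fin n → Fin n → ℕ)
    (G : Fin n → ℕ) (w i j : Fin n) : Prop :=
  1 ≤ G j ∧ G j ≤ n ∧ mpref j (G j) = w ∧ rank w j < rank w i

/-- Every woman whom a man has moved past currently has a suitor she strictly prefers to him. -/
def RejectionsJustified (mpref : Fin n → ℕ → Fin n) (rank : Fin n → Fin n → ℕ)
    (G : Fin n → ℕ) : Prop :=
  ∀ i k, 1 ≤ k → k < G i → ∃ j, Outbids mpref rank G (mpref i k) i j

theorem gsUpdate_of_ne {i i' : Fin n} (h : i' ≠ i) (G : Fin n → ℕ) :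
    gsUpdate mpref rank i G i' = G i' := by
  simp [gsUpdate, h]

theorem gsUpdate_self_cases (i : Fin n) (G : Fin n → ℕ) :
    (G i = 0 ∧ gsUpdate mpref rank i G i = 1) ∨
    (1 ≤ G i ∧ G i ≤ n ∧ (∃ j, Outbids mpref rank G (mpref i (G i)) i j) ∧
      gsUpdate mpref rank i G i = G i + 1) ∨
    (1 ≤ G i ∧ (G i ≤ n → ¬ ∃ j, Outbids mpref rank G (mpref i (G i)) i j) ∧
      gsUpdate mpref rank i G i = G i) := by
  have hne : (∃ j, j ≠ i ∧ 1 ≤ G j ∧ G j ≤ n ∧ mpref j (G j) = mpref i (G i) ∧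
      rank (mpref i (G i)) j < rank (mpref i (G i)) i) ↔
      ∃ j, Outbids mpref rank G (mpref i (G i)) i j := by
    refine exists_congr fun j => and_iff_right_of_imp ?_
    rintro ⟨-, -, -, h⟩ rfl
    exact lt_irrefl _ h
  simp only [gsUpdate, if_true, ← hne]
  split_ifs with h0 h1 h2
  · exact .inl ⟨h0, rfl⟩
  · exact .inr (.inr ⟨by omega, fun h => by omega, rfl⟩)
  · exact .inr (.inl ⟨by omega, by omega, h2, rfl⟩)
  · exact .inr (.inr ⟨by omega, fun _ => h2, rfl⟩)

theorem le_gsUpdate (i : Fin n) (G : Fin n → ℕ) : G ≤ gsUpdate mpref rank i G := by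
  intro i'
  change G i' ≤ gsUpdate mpref rank i G i'
  by_cases h : i' = i
  · subst h
    rcases gsUpdate_self_cases (mpref := mpref) (rank := rank) i' G with h | h | h <;> omega
  · rw [gsUpdate_of_ne h]

/-- An update never lowers the quality of a woman's best suitor. -/
theorem Outbids.exists_gsUpdate {G : Fin n → ℕ} {w a b : Fin n}
    (h : Outbids mpref rank G w a b) (i : Fin n) :
    ∃ j, Outbids mpref rank (gsUpdate mpref rank i G) w a j := by
  by_cases hb : b = i
  · subst hb
    obtain ⟨h1, h2, h3, h4⟩ := h
    rcases gsUpdate_self_cases (mpref := mpref) (rank := rank) b G with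
      h | ⟨-, -, ⟨j, hj1, hj2, hj3, hj4⟩, -⟩ | ⟨-, -, he⟩
    · omega
    · have hjb : j ≠ b := by
        rintro rfl
        exact lt_irrefl _ hj4
      rw [h3] at hj3 hj4
      refine ⟨j, ?_⟩
      rw [Outbids, gsUpdate_of_ne hjb]
      exact ⟨hj1, hj2, hj3, hj4.trans h4⟩
    · refine ⟨b, ?_⟩
      rw [Outbids, he]
      exact ⟨h1, h2, h3, h4⟩
  · refine ⟨b, ?_⟩
    rw [Outbids, gsUpdate_of_ne hb]
    exact h

theorem RejectionsJustified.gsUpdate {G : Fin n → ℕ}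
    (h : RejectionsJustified mpref rank G) (i : Fin n) :
    RejectionsJustified mpref rank (gsUpdate mpref rank i G) := by
  intro a k hk hka
  suffices ∃ j, Outbids mpref rank G (mpref a k) a j from
    this.elim fun _ hj => hj.exists_gsUpdate i
  rcases lt_or_ge k (G a) with hlt | hge
  · exact h a k hk hlt
  · by_cases ha : a = i
    · subst ha
      rcases gsUpdate_self_cases (mpref := mpref) (rank := rank) a G with
        h | ⟨-, -, hj, he⟩ | h
      · omega
      · obtain rfl : k = G a := by omega
        exact hj
      · omega
    · rw [gsUpdate_of_ne ha] at hka
      omega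

/-- No man exhausts his list: otherwise all `n` women would have suitors among the
other `n - 1` men. -/
theorem RejectionsJustified.le {G : Fin n → ℕ}
    (hmpref : ∀ i, Set.BijOn (mpref i) (Set.Icc 1 n) Set.univ)
    (h : RejectionsJustified mpref rank G) (i : Fin n) : G i ≤ n := by
  by_contra! hi
  have hw : ∀ w, ∃ j, G j ≤ n ∧ mpref j (G j) = w := by
    intro w
    obtain ⟨k, ⟨hk1, hkn⟩, rfl⟩ := (hmpref i).surjOn (Set.mem_univ w)
    obtain ⟨j, -, hj, hjw, -⟩ := h i k hk1 (by omega)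
    exact ⟨j, hj, hjw⟩
  choose f hfn hf using hw
  have hinj : Function.Injective f :=
    Function.LeftInverse.injective (g := fun j => mpref j (G j)) hf
  obtain ⟨w, rfl⟩ := Finite.surjective_of_injective hinj i
  exact absurd (hfn w) (by omega)

/-- No man is rejected by his partner in a stable matching `ν`. -/
theorem gsUpdate_le_of_stable
    (hmpref : ∀ i, Set.BijOn (mpref i) (Set.Icc 1 n) Set.univ)
    {ν : Fin n → Fin n} (hν : Function.Injective ν)
    (hstable : ¬ ∃ i j k1 k2, 1 ≤ k1 ∧ k1 ≤ n ∧ 1 ≤ k2 ∧ k2 ≤ n ∧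
      mpref i k1 = ν j ∧ mpref i k2 = ν i ∧ k1 < k2 ∧ rank (ν j) i < rank (ν j) j)
    {G : Fin n → ℕ} (h : ∀ i k, 1 ≤ k → k ≤ n → mpref i k = ν i → G i ≤ k) (i : Fin n) :
    ∀ a k, 1 ≤ k → k ≤ n → mpref a k = ν a → gsUpdate mpref rank i G a ≤ k := by
  intro a k hk hkn hka
  have hle := h a k hk hkn hka
  by_cases ha : a = i
  · subst ha
    rcases gsUpdate_self_cases (mpref := mpref) (rank := rank) a G with
      h' | ⟨-, -, ⟨j, hj1, hjn, hjw, hjr⟩, he⟩ | h'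
    · omega
    · by_contra! hlt
      obtain rfl : G a = k := by omega
      rw [hka] at hjw hjr
      obtain ⟨m, ⟨hm1, hmn⟩, hm⟩ := (hmpref j).surjOn (Set.mem_univ (ν j))
      have hjm : G j ≠ m := by
        rintro rfl
        obtain rfl : j = a := hν (hm.symm.trans hjw)
        exact lt_irrefl _ hjr
      have := h j m hm1 hmn hm
      exact hstable ⟨j, a, G j, m, hj1, hjn, hm1, hmn, hjw, hm, by omega, hjr⟩
    · omega
  · rwa [gsUpdate_of_ne ha]

/-- A monotone sequence of tuples with entries at most `N` is eventually constant. -/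
theorem Monotone.eventually_const_of_le {ι : Type*} [Finite ι] {G : ℕ → ι → ℕ} {N : ℕ}
    (hG : Monotone G) (hN : ∀ t i, G t i ≤ N) : ∃ T, ∀ t, T ≤ t → G t = G T := by
  let F : ℕ →o (ι → Fin (N + 1)) :=
    ⟨fun t i => ⟨G t i, Nat.lt_succ_of_le (hN t i)⟩, fun _ _ hst i => hG hst i⟩
  obtain ⟨T, hT⟩ := WellFoundedGT.monotone_chain_condition F
  exact ⟨T, fun t ht => funext fun i => (congrArg Fin.val (congrFun (hT t ht) i)).symm⟩

end GaleShapley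

/-- Correctness of lock-free Gale–Shapley under fair interleaving:
a fair interleaved execution of the proposal updates from `G₀ = (0,…,0)` stabilizes at
`G*`, every `G* i` lies in `{1,…,n}`, the induced map `μ i = mpref i (G* i)` is a
bijection, `μ` is stable (no blocking pair), and `μ` is man-optimal: for every stable
perfect matching `ν`, each man weakly prefers his `μ`-partner to his `ν`-partner. -/
theorem stmt_13 {n : ℕ} (mpref : Fin n → ℕ → Fin n) (rank : Fin n → Fin n → ℕ)
    (hmpref : ∀ i, Set.BijOn (mpref i) (Set.Icc 1 n) Set.univ)
    (hrank : ∀ w, Set.BijOn (rank w) Set.univ (Set.Icc 1 n))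
    (σ : ℕ → Fin n) (hfair : ∀ i, {t | σ t = i}.Infinite)
    (G : ℕ → Fin n → ℕ) (hG0 : G 0 = fun _ => 0)
    (hstep : ∀ t, G (t + 1) = gsUpdate mpref rank (σ t) (G t)) :
    ∃ T, (∀ t, T ≤ t → G t = G T) ∧
      (∀ i, 1 ≤ G T i ∧ G T i ≤ n) ∧
      Function.Bijective (fun i => mpref i (G T i)) ∧
      (¬ ∃ i j k, 1 ≤ k ∧ k < G T i ∧ mpref i k = mpref j (G T j) ∧
          rank (mpref i k) i < rank (mpref i k) j) ∧
      (∀ ν : Fin n → Fin n, Function.Bijective ν →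
        (¬ ∃ i j k1 k2, 1 ≤ k1 ∧ k1 ≤ n ∧ 1 ≤ k2 ∧ k2 ≤ n ∧
            mpref i k1 = ν j ∧ mpref i k2 = ν i ∧ k1 < k2 ∧
            rank (ν j) i < rank (ν j) j) →
        ∀ i k, 1 ≤ k → k ≤ n → mpref i k = ν i → G T i ≤ k) := by
  have hmono : Monotone G := monotone_nat_of_le_succ fun t => hstep t ▸ le_gsUpdate _ _
  have hjust : ∀ t, RejectionsJustified mpref rank (G t) := by
    intro t
    induction t with
    | zero => simp [RejectionsJustified, hG0]
    | succ t ih => exact hstep t ▸ ih.gsUpdate _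
  have hle : ∀ t i, G t i ≤ n := fun t => (hjust t).le hmpref
  obtain ⟨T, hT⟩ := hmono.eventually_const_of_le hle
  have hfix : ∀ i, gsUpdate mpref rank i (G T) = G T := by
    intro i
    obtain ⟨t, rfl, ht⟩ := (hfair i).exists_gt T
    rw [← hT t ht.le, ← hstep, hT t ht.le, hT (t + 1) (by omega)]
  have hfinal : ∀ i, 1 ≤ G T i ∧ ¬ ∃ j, Outbids mpref rank (G T) (mpref i (G T i)) i j := by
    intro i
    have hi := congrFun (hfix i) i
    rcases gsUpdate_self_cases (mpref := mpref) (rank := rank) i (G T) with h | h | h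
    · omega
    · omega
    · exact ⟨h.1, h.2.1 (hle T i)⟩
  have hinj : Function.Injective (fun i => mpref i (G T i)) := by
    intro i j hij
    have hrank_le : ∀ a b, mpref a (G T a) = mpref b (G T b) →
        rank (mpref a (G T a)) a ≤ rank (mpref a (G T a)) b := by
      intro a b hab
      by_contra! hlt
      exact (hfinal a).2 ⟨b, (hfinal b).1, hle T b, hab.symm, hlt⟩
    refine (hrank _).injOn (Set.mem_univ i) (Set.mem_univ j) ((hrank_le i j hij).antisymm ?_)
    have := hrank_le j i hij.symm
    rwa [← show mpref i (G T i) = mpref j (G T j) from hij] at this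
  refine ⟨T, hT, fun i => ⟨(hfinal i).1, hle T i⟩,
    Finite.injective_iff_bijective.mp hinj, ?_, ?_⟩
  · rintro ⟨i, j, k, hk, hki, hkj, hr⟩
    obtain ⟨j', -, -, hj', hr'⟩ := hjust T i k hk hki
    obtain rfl : j' = j := hinj (hj'.trans hkj)
    exact lt_asymm hr hr'
  · intro ν hν hstable
    suffices ∀ t i k, 1 ≤ k → k ≤ n → mpref i k = ν i → G t i ≤ k from this T
    intro t
    induction t with
    | zero => simp [hG0]
    | succ t ih => exact hstep t ▸ gsUpdate_le_of_stable hmpref hν.injective hstable ih _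
end

section
/- (Single-source shortest paths via fair relaxation.) Let E ⊆ Fin n × Fin n be the edge set of a directed graph with edge weights w : Fin n × Fin n → ℕ, let T = max over edges of w, and fix the source vertex s. Let L = (Fin n → {0,…,nT}) ordered componentwise and initialize G_0[i] = w(s,i) if (s,i) ∈ E and G_0[i] = nT otherwise. For each i define f_i : L → L by f_i(G)[i] = min(G[i], min over k with (k,i) ∈ E of (G[k] + w(k,i))) and f_i(G)[j] = G[j] for j ≠ i. Each f_i is deflationary, monotone, and i-local. For any fair schedule σ : ℕ → Fin n, the execution G_{t+1} = f_{σ(t)}(G_t) from G_0 stabilizes at some G*, and for every vertex i ≠ s: G*[i] = min(nT, d(s,i)), where d(s,i) is the minimum total weight of a nonempty directed walk from s to i in E (and G*[i] = nT if no such walk exists). -/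
/-- The single-source edge-relaxation update `f_i`: coordinate `i` becomes
`min (G i, min over edges (k,i) ∈ E of (G k + w (k,i)))`, all other coordinates are
unchanged. -/
def relax {n : ℕ} (E : Finset (Fin n × Fin n)) (w : Fin n × Fin n → ℕ)
    (i : Fin n) (G : Fin n → ℕ) : Fin n → ℕ :=
  fun j =>
    if j = i then
      Finset.fold min (G i) (fun p => G p.1 + w p) (E.filter fun p => p.2 = i)
    else G j

theorem le_relax_self_iff {n : ℕ} (E : Finset (Fin n × Fin n)) (w : Fin n × Fin n → ℕ)
    (i : Fin n) (H : Fin n → ℕ) (r : ℕ) :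
    r ≤ relax E w i H i ↔ r ≤ H i ∧ ∀ k, (k, i) ∈ E → r ≤ H k + w (k, i) := by
  simp only [relax, if_true, Finset.le_fold_min, Finset.mem_filter, Prod.forall]
  refine and_congr_right fun _ => ⟨fun h k hk => h k i ⟨hk, rfl⟩, ?_⟩
  rintro h a b ⟨hab, rfl⟩
  exact h a hab

theorem relax_of_ne {n : ℕ} (E : Finset (Fin n × Fin n)) (w : Fin n × Fin n → ℕ)
    {i j : Fin n} (h : j ≠ i) (H : Fin n → ℕ) : relax E w i H j = H j :=
  if_neg h

theorem relax_le {n : ℕ} (E : Finset (Fin n × Fin n)) (w : Fin n × Fin n → ℕ)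
    (i : Fin n) (H : Fin n → ℕ) : relax E w i H ≤ H := by
  intro j
  rcases eq_or_ne j i with rfl | h
  · exact ((le_relax_self_iff E w j H _).1 le_rfl).1
  · exact (relax_of_ne E w h H).le

theorem relax_monotone {n : ℕ} (E : Finset (Fin n × Fin n)) (w : Fin n × Fin n → ℕ)
    (i : Fin n) : Monotone (relax E w i) := by
  intro H K hHK j
  rcases eq_or_ne j i with rfl | h
  · obtain ⟨h₁, h₂⟩ := (le_relax_self_iff E w j H _).1 le_rfl
    exact (le_relax_self_iff E w j K _).2
      ⟨h₁.trans (hHK j), fun k hk => (h₂ k hk).trans (Nat.add_le_add_right (hHK k) _)⟩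
  · simpa only [relax_of_ne E w h] using hHK j

/-- The total weights of the nonempty directed walks from `s` to `i`. -/
def walkWeights {n : ℕ} (E : Finset (Fin n × Fin n)) (w : Fin n × Fin n → ℕ)
    (s i : Fin n) : Set ℕ :=
  {W | ∃ l, 1 ≤ l ∧ ∃ c : ℕ → Fin n, c 0 = s ∧ c l = i ∧
    (∀ u < l, (c u, c (u + 1)) ∈ E) ∧ W = ∑ u ∈ Finset.range l, w (c u, c (u + 1))}

section

variable {n : ℕ} {E : Finset (Fin n × Fin n)} {w : Fin n × Fin n → ℕ} {s : Fin n}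

theorem weight_mem_walkWeights {i : Fin n} (h : (s, i) ∈ E) :
    w (s, i) ∈ walkWeights E w s i :=
  ⟨1, le_rfl, fun u => if u = 0 then s else i, by simp, by simp, by simpa using h, by simp⟩

theorem add_weight_mem_walkWeights {k i : Fin n} {W : ℕ} (hW : W ∈ walkWeights E w s k)
    (h : (k, i) ∈ E) : W + w (k, i) ∈ walkWeights E w s i := by
  obtain ⟨l, hl, c, hc0, hcl, hc, rfl⟩ := hW
  have hlt : ∀ u < l, (if u ≤ l then c u else i) = c u ∧
      (if u + 1 ≤ l then c (u + 1) else i) = c (u + 1) := fun u hu =>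
    ⟨if_pos hu.le, if_pos hu⟩
  refine ⟨l + 1, by omega, fun u => if u ≤ l then c u else i, by simpa using hc0, by simp,
    fun u hu => ?_, ?_⟩
  · rcases Nat.lt_succ_iff_lt_or_eq.1 hu with hu | rfl
    · simpa only [hlt u hu] using hc u hu
    · simpa [hcl] using h
  · rw [Finset.sum_range_succ]
    congr 1
    · refine Finset.sum_congr rfl fun u hu => ?_
      simp only [hlt u (Finset.mem_range.1 hu)]
    · simp [hcl]

/-- A labelling that is at most the weight of each edge out of `s` and satisfies the triangle
inequality along edges bounds every walk weight from below. -/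
theorem le_of_mem_walkWeights {H : Fin n → ℕ} (hs : ∀ i, (s, i) ∈ E → H i ≤ w (s, i))
    (hH : ∀ k i, (k, i) ∈ E → H i ≤ H k + w (k, i)) {i : Fin n} {W : ℕ}
    (hW : W ∈ walkWeights E w s i) : H i ≤ W := by
  obtain ⟨l, hl, c, rfl, rfl, hc, rfl⟩ := hW
  induction l, hl using Nat.le_induction with
  | base => simpa using hs _ (hc 0 one_pos)
  | succ l hl ih =>
    rw [Finset.sum_range_succ]
    exact (hH _ _ (hc l l.lt_succ_self)).trans
      (Nat.add_le_add_right (ih fun u hu => hc u (hu.trans l.lt_succ_self)) _)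

/-- Relaxation preserves the property that each value is a walk weight or at least `B`. -/
theorem mem_walkWeights_or_le_relax {H : Fin n → ℕ} {B : ℕ}
    (hH : ∀ i, H i ∈ walkWeights E w s i ∨ B ≤ H i) (i j : Fin n) :
    relax E w i H j ∈ walkWeights E w s j ∨ B ≤ relax E w i H j := by
  rcases eq_or_ne j i with rfl | h
  · by_contra! hcon
    obtain ⟨hmem, hlt⟩ := hcon
    obtain ⟨h₁, h₂⟩ := (le_relax_self_iff E w j H _).1 le_rfl
    have key : relax E w j H j + 1 ≤ relax E w j H j := by
      refine (le_relax_self_iff E w j H _).2 ⟨?_, fun k hk => ?_⟩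
      · refine Nat.lt_of_le_of_ne h₁ fun e => ?_
        rcases hH j with hj | hj
        · exact hmem (e ▸ hj)
        · omega
      · refine Nat.lt_of_le_of_ne (h₂ k hk) fun e => ?_
        rcases hH k with hj | hj
        · exact hmem (e ▸ add_weight_mem_walkWeights hj hk)
        · omega
    omega
  · simpa only [relax_of_ne E w h] using hH j

/-- Any execution of the relaxations is eventually constant, and under a fair schedule its final
value is a common fixed point. -/
theorem exists_stable_relax {σ : ℕ → Fin n} (hfair : ∀ i, {t | σ t = i}.Infinite)
    {G : ℕ → Fin n → ℕ} (hstep : ∀ t, G (t + 1) = relax E w (σ t) (G t)) :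
    ∃ T', (∀ t, T' ≤ t → G t = G T') ∧ ∀ i, relax E w i (G T') = G T' := by
  have hanti : Antitone G := antitone_nat_of_succ_le fun t => hstep t ▸ relax_le E w _ _
  obtain ⟨T', hT'⟩ := WellFoundedGT.monotone_chain_condition
    (⟨fun t => OrderDual.toDual (G t), fun _ _ h => hanti h⟩ : ℕ →o (Fin n → ℕ)ᵒᵈ)
  have hst : ∀ t, T' ≤ t → G t = G T' := fun t ht => (hT' t ht).symm
  refine ⟨T', hst, fun i => ?_⟩
  obtain ⟨t, rfl, hlt⟩ := (hfair i).exists_gt T'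
  rw [← hst t hlt.le, ← hstep, hst _ (by omega), hst t hlt.le]

end

/-- Single-source shortest paths via fair relaxation: each `relax E w i`
is deflationary, monotone and `i`-local; a fair interleaved execution from the initial
state (edge weights from `s`, else `n*T` where `T` is the largest edge weight) stabilizes,
and at stabilization each coordinate `i ≠ s` equals `min (n*T) d(s,i)` where `d(s,i)` is
the least total weight of a nonempty directed walk from `s` to `i` (and equals `n*T`
when no such walk exists). -/
theorem stmt_14 {n : ℕ} (E : Finset (Fin n × Fin n)) (w : Fin n × Fin n → ℕ)
    (T : ℕ) (hT : T = E.sup w) (s : Fin n)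
    (σ : ℕ → Fin n) (hfair : ∀ i, {t | σ t = i}.Infinite)
    (G : ℕ → Fin n → ℕ)
    (hG0 : ∀ i, G 0 i = if (s, i) ∈ E then w (s, i) else n * T)
    (hstep : ∀ t, G (t + 1) = relax E w (σ t) (G t)) :
    (∀ i : Fin n, (∀ H : Fin n → ℕ, relax E w i H ≤ H) ∧ Monotone (relax E w i) ∧
        (∀ (H : Fin n → ℕ) (j : Fin n), j ≠ i → relax E w i H j = H j)) ∧
    ∃ T', (∀ t, T' ≤ t → G t = G T') ∧
      ∀ i : Fin n, i ≠ s →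
        (∀ d, IsLeast {W | ∃ l, 1 ≤ l ∧ ∃ c : ℕ → Fin n, c 0 = s ∧ c l = i ∧
              (∀ u < l, (c u, c (u + 1)) ∈ E) ∧
              W = ∑ u ∈ Finset.range l, w (c u, c (u + 1))} d →
            G T' i = min (n * T) d) ∧
        ({W | ∃ l, 1 ≤ l ∧ ∃ c : ℕ → Fin n, c 0 = s ∧ c l = i ∧
              (∀ u < l, (c u, c (u + 1)) ∈ E) ∧
              W = ∑ u ∈ Finset.range l, w (c u, c (u + 1))} = ∅ →
            G T' i = n * T) := by
  refine ⟨fun i => ⟨relax_le E w i, relax_monotone E w i, fun H j h => relax_of_ne E w h H⟩, ?_⟩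
  have hanti : Antitone G := antitone_nat_of_succ_le fun t => hstep t ▸ relax_le E w _ _
  have hinv : ∀ t i, G t i ∈ walkWeights E w s i ∨ n * T ≤ G t i := by
    intro t
    induction t with
    | zero =>
      intro i
      rw [hG0]
      split_ifs with h
      · exact Or.inl (weight_mem_walkWeights h)
      · exact Or.inr le_rfl
    | succ t ih => exact hstep t ▸ mem_walkWeights_or_le_relax ih (σ t)
  have hle : ∀ t i, G t i ≤ n * T := by
    intro t i
    refine (hanti t.zero_le i).trans ?_
    rw [hG0]
    split_ifs with h
    · exact (hT ▸ Finset.le_sup h).trans (Nat.le_mul_of_pos_left T s.pos)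
    · exact le_rfl
  obtain ⟨T', hst, hfix⟩ := exists_stable_relax hfair hstep
  refine ⟨T', hst, fun i _ => ⟨fun d hd => ?_, fun hempty => ?_⟩⟩
  · have hs : ∀ j, (s, j) ∈ E → G T' j ≤ w (s, j) := fun j hj =>
      (hanti T'.zero_le j).trans (by rw [hG0, if_pos hj])
    have hedge : ∀ k j, (k, j) ∈ E → G T' j ≤ G T' k + w (k, j) := fun k j =>
      ((le_relax_self_iff E w j (G T') _).1 (congrFun (hfix j) j).ge).2 k
    refine le_antisymm (le_min (hle T' i) (le_of_mem_walkWeights hs hedge hd.1)) ?_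
    exact (hinv T' i).elim (fun h => min_le_of_right_le (hd.2 h)) min_le_of_left_le
  · refine le_antisymm (hle T' i) ((hinv T' i).resolve_left fun h => ?_)
    exact (hempty ▸ h : G T' i ∈ (∅ : Set ℕ))
end

section
/- (Fair iteration computes the least envy-eliminating payment vector.) Let n ∈ ℕ and V : Fin n → Fin n → ℤ, with f_i : (Fin n → ℤ) → (Fin n → ℤ) defined by f_i(p) i = max(p i, max over j ≠ i of (V i j + p j − V i i)) and f_i(p) j = p j for j ≠ i. Assume the allocation X is envy-freeable: there exists q : Fin n → ℤ with q ≥ 0 and V i i + q i ≥ V i j + q j for all i, j. Let σ : ℕ → Fin n be a fair schedule, p_0 = 0, and p_{t+1} = f_{σ(t)}(p_t). Then there exists T such that p_t = p_T =: p* for all t ≥ T, p* ≥ 0, (X, p*) is envy-free, and p* is the componentwise least envy-eliminating vector above 0: p* ≤ q for every q ≥ 0 with V i i + q i ≥ V i j + q j for all i, j. -/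
/-- The subsidy update `f_i`: agent `i`'s payment becomes
`max (p i, max over j ≠ i of (V i j + p j − V i i))`; other coordinates are unchanged. -/
def subsidyUpdate {n : ℕ} (V : Fin n → Fin n → ℤ) (i : Fin n) (p : Fin n → ℤ) :
    Fin n → ℤ :=
  fun j =>
    if j = i then
      Finset.fold max (p i) (fun k => V i k + p k - V i i) (Finset.univ.erase i)
    else p j

theorem subsidyUpdate_apply_self_le_iff {n : ℕ} {V : Fin n → Fin n → ℤ} {i : Fin n}
    {p : Fin n → ℤ} {c : ℤ} :
    subsidyUpdate V i p i ≤ c ↔ p i ≤ c ∧ ∀ k, k ≠ i → V i k + p k - V i i ≤ c := by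
  simp [subsidyUpdate, Finset.fold_max_le]

theorem subsidyUpdate_apply_of_ne {n : ℕ} (V : Fin n → Fin n → ℤ) {i j : Fin n}
    (p : Fin n → ℤ) (h : j ≠ i) : subsidyUpdate V i p j = p j :=
  if_neg h

theorem le_subsidyUpdate {n : ℕ} (V : Fin n → Fin n → ℤ) (i : Fin n) (p : Fin n → ℤ) :
    p ≤ subsidyUpdate V i p := by
  intro j
  rcases eq_or_ne j i with rfl | h
  · exact (subsidyUpdate_apply_self_le_iff.1 le_rfl).1
  · rw [subsidyUpdate_apply_of_ne V p h]

/-- Vectors eliminating the envy of agent `i` bound `f_i` on everything below them. -/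
theorem subsidyUpdate_le {n : ℕ} {V : Fin n → Fin n → ℤ} {i : Fin n} {p q : Fin n → ℤ}
    (hpq : p ≤ q) (hq : ∀ j, V i j + q j ≤ V i i + q i) : subsidyUpdate V i p ≤ q := by
  intro j
  rcases eq_or_ne j i with rfl | h
  · refine subsidyUpdate_apply_self_le_iff.2 ⟨hpq j, fun k _ => ?_⟩
    linarith [hpq k, hq k]
  · exact (subsidyUpdate_apply_of_ne V p h).trans_le (hpq j)

/-- At a fixed point of `f_i`, agent `i` envies nobody. -/
theorem envy_le_of_subsidyUpdate_eq {n : ℕ} {V : Fin n → Fin n → ℤ} {i : Fin n}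
    {p : Fin n → ℤ} (h : subsidyUpdate V i p = p) (j : Fin n) :
    V i j + p j ≤ V i i + p i := by
  rcases eq_or_ne j i with rfl | hj
  · exact le_rfl
  · linarith [(subsidyUpdate_apply_self_le_iff.1 (congrFun h i).le).2 j hj]

/-- Fair iteration computes the least envy-eliminating payment vector:
if the allocation is envy-freeable, then a fair interleaved execution of the subsidy
updates starting from `p₀ = 0` stabilizes at `p* ≥ 0` which is envy-eliminating and is
componentwise least among envy-eliminating vectors above `0`. -/
theorem stmt_18 {n : ℕ} (V : Fin n → Fin n → ℤ)
    (hEF : ∃ q : Fin n → ℤ, 0 ≤ q ∧ ∀ i j, V i j + q j ≤ V i i + q i)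
    (σ : ℕ → Fin n) (hfair : ∀ i, {t | σ t = i}.Infinite)
    (p : ℕ → Fin n → ℤ) (hp0 : p 0 = 0)
    (hstep : ∀ t, p (t + 1) = subsidyUpdate V (σ t) (p t)) :
    ∃ T, (∀ t, T ≤ t → p t = p T) ∧ 0 ≤ p T ∧
      (∀ i j, V i j + p T j ≤ V i i + p T i) ∧
      ∀ q : Fin n → ℤ, 0 ≤ q → (∀ i j, V i j + q j ≤ V i i + q i) → p T ≤ q := by
  have hmono : Monotone p := monotone_nat_of_le_succ fun t => by
    rw [hstep t]
    exact le_subsidyUpdate V (σ t) (p t)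
  have hnonneg (t : ℕ) : 0 ≤ p t := hp0 ▸ hmono t.zero_le
  have hle (q : Fin n → ℤ) (hq0 : 0 ≤ q) (hq : ∀ i j, V i j + q j ≤ V i i + q i) (t : ℕ) :
      p t ≤ q := by
    induction t with
    | zero => rwa [hp0]
    | succ t ih =>
      rw [hstep t]
      exact subsidyUpdate_le ih (hq (σ t))
  obtain ⟨q, hq0, hq⟩ := hEF
  obtain ⟨T, hT⟩ := WellFoundedGT.monotone_chain_condition
    (⟨fun t => ⟨p t, hnonneg t, hle q hq0 hq t⟩, fun _ _ h => hmono h⟩ : ℕ →o Set.Icc 0 q)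
  have hstable (t : ℕ) (ht : T ≤ t) : p t = p T := (congrArg Subtype.val (hT t ht)).symm
  refine ⟨T, hstable, hnonneg T, fun i => ?_, fun q hq0 hq => hle q hq0 hq T⟩
  obtain ⟨t, rfl, ht⟩ := (hfair i).exists_gt T
  apply envy_le_of_subsidyUpdate_eq
  rw [← hstable t ht.le, ← hstep t, hstable t ht.le, hstable (t + 1) (by omega)]
end
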